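/- arXiv:1602.06922 — 2 statements merged into one kernel-verified Lean document; each statement's English description precedes it below -/
import Mathlib

section
/- For every γ ≥ 1 there exist constants C(γ), C'(γ) > 0 such that for every d ≥ 2 there exist integers m ≤ C(γ)(ln d)³ and k ≤ C(γ)(ln d)², together with a map Z : {0,1}^k → ℝ^{m×d} (a family of m×d matrices indexed by k random bits), with the following property: for every pair of unit vectors x, y ∈ S^{d−1}, if ω is drawn uniformly from {0,1}^k, then with probability at least 1 − C'(γ) d^{−γ} all three of the following hold: (1 − 1/ln d) ≤ ‖Z_ω x‖₂² ≤ (1 + 1/ln d); (1 − 1/ln d) ≤ ‖Z_ω y‖₂² ≤ (1 + 1/ln d); and (1 − 1/ln d)‖x − y‖₂² ≤ ‖Z_ω(x − y)‖₂² ≤ (1 + 1/ln d)‖x − y‖₂². -/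
open MeasureTheory
open scoped ENNReal

/-- The uniform probability measure on a finite type (normalized counting measure). -/
noncomputable def uniformCount (α : Type*) [MeasurableSpace α] : Measure α :=
  (Nat.card α : ℝ≥0∞)⁻¹ • Measure.count

/-- A finite sample space of sign vectors whose coordinates are, under the uniform measure on `Ω`,
uncorrelated up to order `t`: the product of any nonempty set of at most `t` coordinates has
mean zero. -/
structure IsSignDesign {Ω ι : Type*} [Fintype Ω] (t : ℕ) (s : Ω → ι → ℝ) : Prop where
  sq_eq_one : ∀ ω i, s ω i ^ 2 = 1
  sum_prod_eq_zero : ∀ A : Finset ι, A.Nonempty → A.card ≤ t → ∑ ω, ∏ i ∈ A, s ω i = 0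

namespace IsSignDesign

variable {Ω Ω' ι : Type*} [Fintype Ω] [Fintype Ω'] {t : ℕ} {s : Ω → ι → ℝ} {s' : Ω' → ι → ℝ}

theorem comp_equiv (h : IsSignDesign t s) (e : Ω' ≃ Ω) : IsSignDesign t (fun ω => s (e ω)) where
  sq_eq_one ω i := h.sq_eq_one (e ω) i
  sum_prod_eq_zero A hA hc := by
    rw [← h.sum_prod_eq_zero A hA hc]
    exact Equiv.sum_comp e (fun ω => ∏ i ∈ A, s ω i)

theorem sum_monomial [Fintype ι] (h : IsSignDesign t s) (e : ι → ℕ) (he : ∑ i, e i ≤ t) :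
    ∑ ω, ∏ i, s ω i ^ e i = Fintype.card Ω * if ∀ i, Even (e i) then (1 : ℝ) else 0 := by
  classical
  have key : ∀ ω, ∏ i, s ω i ^ e i = ∏ i ∈ Finset.univ.filter (fun i => ¬ Even (e i)), s ω i := by
    intro ω
    rw [Finset.prod_filter]
    refine Finset.prod_congr rfl fun i _ => ?_
    split_ifs with hi
    · obtain ⟨r, hr⟩ := hi
      rw [hr, ← two_mul, pow_mul, h.sq_eq_one, one_pow]
    · obtain ⟨r, hr⟩ := Nat.not_even_iff_odd.mp hi
      rw [hr, pow_succ, pow_mul, h.sq_eq_one, one_pow, one_mul]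
  simp_rw [key]
  split_ifs with hall
  · rw [Finset.filter_false_of_mem (by simpa using hall)]
    simp
  · rw [mul_zero]
    apply h.sum_prod_eq_zero
    · obtain ⟨i, hi⟩ := not_forall.mp hall
      exact ⟨i, by simpa using hi⟩
    · refine le_trans ?_ he
      rw [Finset.card_eq_sum_ones, Finset.sum_filter]
      refine Finset.sum_le_sum fun i _ => ?_
      split_ifs with hi
      · exact Nat.zero_le _
      · exact (Nat.not_even_iff_odd.mp hi).pos

theorem sum_eval [Fintype ι] (h : IsSignDesign t s) (P : MvPolynomial ι ℝ)
    (hP : P.totalDegree ≤ t) :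
    ∑ ω, MvPolynomial.eval (s ω) P =
      Fintype.card Ω * ∑ e ∈ P.support, P.coeff e * if ∀ i, Even (e i) then (1 : ℝ) else 0 := by
  simp_rw [MvPolynomial.eval_eq']
  rw [Finset.sum_comm, Finset.mul_sum]
  refine Finset.sum_congr rfl fun e he => ?_
  rw [← Finset.mul_sum, h.sum_monomial (fun i => e i)]
  · ring
  · refine le_trans ?_ hP
    refine le_trans (le_of_eq ?_) (MvPolynomial.le_totalDegree he)
    rw [Finsupp.sum_fintype _ _ (fun _ => rfl)]

/-- Two sign designs of strength `t` give the same average to polynomials of degree at most `t`. -/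
theorem card_mul_sum_eval [Fintype ι] (h : IsSignDesign t s) (h' : IsSignDesign t s')
    (P : MvPolynomial ι ℝ) (hP : P.totalDegree ≤ t) :
    Fintype.card Ω' * ∑ ω, MvPolynomial.eval (s ω) P =
      Fintype.card Ω * ∑ ω, MvPolynomial.eval (s' ω) P := by
  rw [h.sum_eval P hP, h'.sum_eval P hP]
  ring

end IsSignDesign

/-- The sign `±1` encoded by a bit. -/
def boolSign (b : Bool) : ℝ := if b then 1 else -1

theorem boolSign_sq (b : Bool) : boolSign b ^ 2 = 1 := by cases b <;> simp [boolSign]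

/-- Independent uniform signs form a design of every strength. -/
theorem isSignDesign_boolSign {ι : Type*} [Fintype ι] [DecidableEq ι] (t : ℕ) :
    IsSignDesign t (fun (ω : ι → Bool) i => boolSign (ω i)) where
  sq_eq_one ω i := boolSign_sq _
  sum_prod_eq_zero A hA _ := by
    have h := Finset.prod_univ_sum (fun _ : ι => (Finset.univ : Finset Bool))
      (fun i b => if i ∈ A then boolSign b else (1 : ℝ))
    rw [Fintype.piFinset_univ] at h
    have h2 : ∀ ω : ι → Bool, ∏ i ∈ A, boolSign (ω i) =
        ∏ i, if i ∈ A then boolSign (ω i) else (1 : ℝ) := by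
      intro ω
      rw [Finset.prod_ite_mem, Finset.univ_inter]
    simp_rw [h2]
    rw [← h]
    obtain ⟨i, hi⟩ := hA
    exact Finset.prod_eq_zero (Finset.mem_univ i) (by simp [hi, boolSign])

/-- The nontrivial character of `ZMod 2`, with real values. -/
def zmodSign (a : ZMod 2) : ℝ := if a = 0 then 1 else -1

theorem zmodSign_add (a b : ZMod 2) : zmodSign (a + b) = zmodSign a * zmodSign b := by
  have h : ∀ c : ZMod 2, c = 0 ∨ c = 1 := by decide
  rcases h a with rfl | rfl <;> rcases h b with rfl | rfl <;>
    simp [zmodSign, show (1 + 1 : ZMod 2) = 0 from rfl]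

theorem zmodSign_sq (a : ZMod 2) : zmodSign a ^ 2 = 1 := by
  unfold zmodSign; split_ifs <;> norm_num

/-- The dual BCH-type design: the sign at `i` is a character of the value at `v i` of the
polynomial of degree less than `t` with coefficient vector `c`. -/
theorem isSignDesign_polynomial {F ι : Type*} [Field F] [Fintype F] (φ : F →+ ZMod 2)
    (hφ : Function.Surjective φ) (t : ℕ) (v : ι → F) (hv : Function.Injective v) :
    IsSignDesign t (fun (c : Fin t → F) i => zmodSign (φ (∑ j, c j * v i ^ (j : ℕ)))) where
  sq_eq_one _ _ := zmodSign_sq _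
  sum_prod_eq_zero A hA hc := by
    classical
    obtain ⟨i₀, hi₀⟩ := hA
    obtain ⟨u, hu⟩ := hφ 1
    set p := Lagrange.interpolate A v (fun i => if i = i₀ then u else 0) with hp
    have hinj : Set.InjOn v A := hv.injOn
    have hdeg : p.degree < (t : ℕ) :=
      (Lagrange.degree_interpolate_lt _ hinj).trans_le (by exact_mod_cast hc)
    have hev : ∀ i ∈ A, ∑ j : Fin t, p.coeff j * v i ^ (j : ℕ) = if i = i₀ then u else 0 := by
      intro i hi
      rw [← Lagrange.eval_interpolate_at_node (fun i => if i = i₀ then u else 0) hinj hi, ← hp,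
        Fin.sum_univ_eq_sum_range (fun j => p.coeff j * v i ^ j) t]
      by_cases hp0 : p = 0
      · simp [hp0]
      · exact (Polynomial.eval_eq_sum_range'
          ((Polynomial.natDegree_lt_iff_degree_lt hp0).mpr hdeg) _).symm
    set f : (Fin t → F) → ℝ := fun c => ∏ i ∈ A, zmodSign (φ (∑ j, c j * v i ^ (j : ℕ))) with hf
    have hflip : ∀ c, f (c + fun j : Fin t => p.coeff j) = - f c := by
      intro c
      have h1 : ∀ i ∈ A, zmodSign (φ (∑ j, (c + fun j : Fin t => p.coeff j) j * v i ^ (j : ℕ))) =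
          zmodSign (φ (∑ j, c j * v i ^ (j : ℕ))) * (if i = i₀ then -1 else 1) := by
        intro i hi
        simp only [Pi.add_apply, add_mul, Finset.sum_add_distrib]
        rw [hev i hi, map_add, zmodSign_add]
        split_ifs <;> simp [hu, zmodSign]
      rw [hf]
      simp only
      rw [Finset.prod_congr rfl h1, Finset.prod_mul_distrib]
      simp [hi₀]
    have hs := Equiv.sum_comp (Equiv.addRight (fun j : Fin t => p.coeff j)) f
    simp only [Equiv.coe_addRight, hflip, Finset.sum_neg_distrib] at hs
    change ∑ c : Fin t → F, f c = 0
    linarith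

/-- A design of strength `t` on at most `2 ^ r` coordinates, sampled with `r * t` random bits. -/
theorem exists_isSignDesign {ι : Type*} [Fintype ι] (r t : ℕ) (hr : r ≠ 0)
    (hι : Fintype.card ι ≤ 2 ^ r) :
    ∃ s : (Fin (r * t) → Bool) → ι → ℝ, IsSignDesign t s := by
  classical
  let F := GaloisField 2 r
  have : Fintype F := Fintype.ofFinite F
  have hF : Fintype.card F = 2 ^ r := by
    rw [← Nat.card_eq_fintype_card]; exact GaloisField.card 2 r hr
  obtain ⟨v⟩ := Function.Embedding.nonempty_of_card_le (hι.trans_eq hF.symm)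
  have hcard : Fintype.card (Fin (r * t) → Bool) = Fintype.card (Fin t → F) := by
    simp [hF, pow_mul]
  exact ⟨_, (isSignDesign_polynomial (Algebra.trace (ZMod 2) F).toAddMonoidHom
    (Algebra.trace_surjective (ZMod 2) F) t v v.injective).comp_equiv
    (Fintype.equivOfCardEq hcard)⟩

theorem sum_exp_mul_boolSign_le {ι : Type*} [Fintype ι] [DecidableEq ι] (x : ι → ℝ) (g : ℝ) :
    ∑ b : ι → Bool, Real.exp (g * ∑ i, x i * boolSign (b i)) ≤
      2 ^ Fintype.card ι * Real.exp (g ^ 2 / 2 * ∑ i, x i ^ 2) := by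
  have h := Finset.prod_univ_sum (fun _ : ι => (Finset.univ : Finset Bool))
    (fun i b => Real.exp (g * (x i * boolSign b)))
  rw [Fintype.piFinset_univ] at h
  simp_rw [Finset.mul_sum, Real.exp_sum]
  rw [← h, ← Finset.card_univ, ← Finset.prod_const, ← Finset.prod_mul_distrib]
  refine Finset.prod_le_prod (fun i _ => Finset.sum_nonneg fun _ _ => (Real.exp_pos _).le)
    fun i _ => ?_
  have h2 := Real.cosh_le_exp_half_sq (g * x i)
  rw [Real.cosh_eq] at h2
  have h3 : g ^ 2 / 2 * x i ^ 2 = (g * x i) ^ 2 / 2 := by ring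
  rw [h3]
  simp only [Fintype.sum_bool, boolSign]
  norm_num
  linarith

theorem integral_exp_neg_sq_add_mul (a : ℝ) :
    ∫ g : ℝ, Real.exp (-g ^ 2 + g * a) = √Real.pi * Real.exp (a ^ 2 / 4) := by
  have h1 : ∀ g : ℝ, Real.exp (-g ^ 2 + g * a) =
      Real.exp (-1 * (g - a / 2) ^ 2) * Real.exp (a ^ 2 / 4) := by
    intro g
    rw [← Real.exp_add]; congr 1; ring
  simp_rw [h1]
  rw [integral_mul_const, integral_sub_right_eq_self (fun g : ℝ => Real.exp (-1 * g ^ 2)) (a / 2),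
    integral_gaussian, div_one]

theorem integrable_exp_neg_sq_add_mul (a : ℝ) :
    Integrable (fun g : ℝ => Real.exp (-g ^ 2 + g * a)) := by
  have h1 : (fun g : ℝ => Real.exp (-g ^ 2 + g * a)) = fun g =>
      Real.exp (-1 * (g - a / 2) ^ 2) * Real.exp (a ^ 2 / 4) := by
    funext g
    rw [← Real.exp_add]; congr 1; ring
  rw [h1]
  exact ((integrable_exp_neg_mul_sq one_pos).comp_sub_right (a / 2)).mul_const _

/-- Square-exponential integrability of a Rademacher sum, by Gaussian linearization. -/
theorem sum_exp_sq_boolSign_le {ι : Type*} [Fintype ι] [DecidableEq ι] (x : ι → ℝ) (hx : ∑ i, x i ^ 2 = 1) :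
    ∑ b : ι → Bool, Real.exp ((∑ i, x i * boolSign (b i)) ^ 2 / 4) ≤
      √2 * 2 ^ Fintype.card ι := by
  have hpi : 0 < √Real.pi := Real.sqrt_pos.mpr Real.pi_pos
  refine le_of_mul_le_mul_left ?_ hpi
  calc √Real.pi * ∑ b : ι → Bool, Real.exp ((∑ i, x i * boolSign (b i)) ^ 2 / 4)
      = ∫ g : ℝ, ∑ b : ι → Bool, Real.exp (-g ^ 2 + g * ∑ i, x i * boolSign (b i)) := by
        rw [integral_finsetSum _ fun b _ => integrable_exp_neg_sq_add_mul _, Finset.mul_sum]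
        exact Finset.sum_congr rfl fun b _ => (integral_exp_neg_sq_add_mul _).symm
    _ ≤ ∫ g : ℝ, 2 ^ Fintype.card ι * Real.exp (-(1 / 2) * g ^ 2) := by
        refine integral_mono (integrable_finsetSum _ fun b _ => integrable_exp_neg_sq_add_mul _)
          ((integrable_exp_neg_mul_sq (by norm_num)).const_mul _) fun g => ?_
        have h := sum_exp_mul_boolSign_le x g
        rw [hx, mul_one] at h
        simp only [Real.exp_add, ← Finset.mul_sum]
        calc _ ≤ Real.exp (-g ^ 2) * (2 ^ Fintype.card ι * Real.exp (g ^ 2 / 2)) := by gcongr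
          _ = 2 ^ Fintype.card ι * (Real.exp (-g ^ 2) * Real.exp (g ^ 2 / 2)) := by ring
          _ = _ := by rw [← Real.exp_add]; congr 2; ring
    _ = √Real.pi * (√2 * 2 ^ Fintype.card ι) := by
        rw [integral_const_mul, integral_gaussian]
        rw [show Real.pi / (1 / 2) = Real.pi * 2 by ring, Real.sqrt_mul Real.pi_pos.le]
        ring

theorem sum_sq_boolSign {ι : Type*} [Fintype ι] [DecidableEq ι] (x : ι → ℝ) :
    ∑ b : ι → Bool, (∑ i, x i * boolSign (b i)) ^ 2 = 2 ^ Fintype.card ι * ∑ i, x i ^ 2 := by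
  have hd := isSignDesign_boolSign (ι := ι) 2
  have hc : ∀ i j, ∑ b : ι → Bool, boolSign (b i) * boolSign (b j) =
      if i = j then 2 ^ Fintype.card ι else 0 := by
    intro i j
    split_ifs with hij
    · subst hij
      simp [← sq, boolSign_sq]
    · have := hd.sum_prod_eq_zero {i, j} (by simp) Finset.card_le_two
      simpa [Finset.prod_pair hij] using this
  simp_rw [sq (∑ i, _), Finset.sum_mul_sum]
  rw [Finset.sum_comm, Finset.mul_sum]
  refine Finset.sum_congr rfl fun i _ => ?_
  rw [Finset.sum_comm]
  have h2 : ∀ j, ∑ b : ι → Bool, x i * boolSign (b i) * (x j * boolSign (b j)) =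
      x i * x j * if i = j then 2 ^ Fintype.card ι else 0 := by
    intro j
    rw [← hc i j, Finset.mul_sum]
    exact Finset.sum_congr rfl fun b _ => by ring
  simp_rw [h2]
  simp
  ring

theorem exp_le_one_add_add_sq_mul_exp_abs (u : ℝ) :
    Real.exp u ≤ 1 + u + u ^ 2 * Real.exp |u| := by
  have h := Complex.norm_exp_sub_sum_le_norm_mul_exp (u : ℂ) 2
  simp only [Finset.sum_range_succ, Finset.sum_range_zero] at h
  norm_num at h
  rw [← Complex.ofReal_exp, ← Complex.ofReal_one, ← Complex.ofReal_add, ← Complex.ofReal_sub,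
    Complex.norm_real, Real.norm_eq_abs] at h
  linarith [le_abs_self (Real.exp u - (1 + u))]

theorem exp_mul_sub_one_le {s v : ℝ} (hs : |s| ≤ 1 / 8) (hv : 0 ≤ v) :
    Real.exp (s * (v - 1)) ≤ 1 + s * (v - 1) + 256 * s ^ 2 * Real.exp (v / 4) := by
  refine (exp_le_one_add_add_sq_mul_exp_abs _).trans ?_
  have hv1 : |v - 1| ≤ v + 1 := abs_le.mpr ⟨by linarith, by linarith⟩
  have h1 : |s * (v - 1)| ≤ (v + 1) / 8 := by
    rw [abs_mul]
    nlinarith [abs_nonneg s, abs_nonneg (v - 1)]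
  have h2 : (v - 1) ^ 2 ≤ (v + 1) ^ 2 := by nlinarith
  have h3 : (v + 1) ^ 2 ≤ 128 * Real.exp ((v + 1) / 8) := by
    have := Real.quadratic_le_exp_of_nonneg (x := (v + 1) / 8) (by positivity)
    nlinarith
  have h4 : Real.exp (1 / 4) ≤ 2 := by
    have h5 : Real.exp (1 / 4) ≤ 1 / (1 - 1 / 4) :=
      Real.exp_bound_div_one_sub_of_interval (by norm_num) (by norm_num)
    norm_num at h5 ⊢
    linarith
  have h6 : (v - 1) ^ 2 * Real.exp |s * (v - 1)| ≤ 256 * Real.exp (v / 4) := by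
    calc (v - 1) ^ 2 * Real.exp |s * (v - 1)|
        ≤ (128 * Real.exp ((v + 1) / 8)) * Real.exp ((v + 1) / 8) := by
          gcongr; exact h2.trans h3
      _ = 128 * Real.exp (v / 4) * Real.exp (1 / 4) := by
          rw [mul_assoc, mul_assoc, ← Real.exp_add, ← Real.exp_add]; congr 2; ring
      _ ≤ 128 * Real.exp (v / 4) * 2 := by gcongr
      _ = _ := by ring
  have h7 : (s * (v - 1)) ^ 2 * Real.exp |s * (v - 1)| =
      s ^ 2 * ((v - 1) ^ 2 * Real.exp |s * (v - 1)|) := by ring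
  rw [h7]
  nlinarith [mul_le_mul_of_nonneg_left h6 (sq_nonneg s)]

theorem sum_exp_mul_sq_sub_one_le {ι : Type*} [Fintype ι] [DecidableEq ι] (x : ι → ℝ) (hx : ∑ i, x i ^ 2 = 1)
    {s : ℝ} (hs : |s| ≤ 1 / 8) :
    ∑ b : ι → Bool, Real.exp (s * ((∑ i, x i * boolSign (b i)) ^ 2 - 1)) ≤
      2 ^ Fintype.card ι * Real.exp (400 * s ^ 2) := by
  have hA := sum_exp_sq_boolSign_le x hx
  have hB := sum_sq_boolSign x
  rw [hx] at hB
  have h2 : √2 ≤ 1.5 := by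
    rw [Real.sqrt_le_left (by norm_num)]; norm_num
  have hp : (0 : ℝ) < 2 ^ Fintype.card ι := by positivity
  calc _ ≤ ∑ b : ι → Bool, (1 + s * ((∑ i, x i * boolSign (b i)) ^ 2 - 1) +
        256 * s ^ 2 * Real.exp ((∑ i, x i * boolSign (b i)) ^ 2 / 4)) :=
        Finset.sum_le_sum fun b _ => exp_mul_sub_one_le hs (sq_nonneg _)
    _ = 2 ^ Fintype.card ι + 256 * s ^ 2 *
          ∑ b : ι → Bool, Real.exp ((∑ i, x i * boolSign (b i)) ^ 2 / 4) := by
        rw [Finset.sum_add_distrib, Finset.sum_add_distrib, ← Finset.mul_sum, ← Finset.mul_sum,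
          Finset.sum_sub_distrib, hB]
        simp
    _ ≤ 2 ^ Fintype.card ι + 256 * s ^ 2 * (1.5 * 2 ^ Fintype.card ι) := by
        gcongr
        exact hA.trans (by gcongr)
    _ ≤ 2 ^ Fintype.card ι * (400 * s ^ 2 + 1) := by nlinarith [mul_nonneg hp.le (sq_nonneg s)]
    _ ≤ _ := by gcongr; exact Real.add_one_le_exp _

/-- The distortion of the squared norm of the unit vector `x` under the matrix `σ / √m`. -/
noncomputable def distortion {m : ℕ} {ι : Type*} [Fintype ι] (x : ι → ℝ) (σ : Fin m × ι → ℝ) : ℝ :=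
  (∑ i, ((∑ j, x j * σ (i, j)) ^ 2 - 1)) / m

theorem sum_exp_distortion_le {ι : Type*} [Fintype ι] [DecidableEq ι] (m : ℕ) (x : ι → ℝ)
    (hx : ∑ i, x i ^ 2 = 1) {l : ℝ} (hl : |l| ≤ m / 8) :
    ∑ b : Fin m → ι → Bool, Real.exp (l * distortion x fun p => boolSign (b p.1 p.2)) ≤
      (2 ^ Fintype.card ι) ^ m * Real.exp (400 * l ^ 2 / m) := by
  rcases Nat.eq_zero_or_pos m with rfl | hm
  · simp [distortion]
  have hm' : (0 : ℝ) < m := by exact_mod_cast hm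
  have hs : |l / m| ≤ 1 / 8 := by
    rw [abs_div, abs_of_pos hm', div_le_iff₀ hm']; linarith
  have h := pow_le_pow_left₀ (Finset.sum_nonneg fun b _ => (Real.exp_pos _).le)
    (sum_exp_mul_sq_sub_one_le x hx hs) m
  rw [Fintype.sum_pow, mul_pow, ← Real.exp_nat_mul] at h
  have h1 : ∀ b : Fin m → ι → Bool, Real.exp (l * distortion x fun p => boolSign (b p.1 p.2)) =
      ∏ i, Real.exp (l / m * ((∑ j, x j * boolSign (b i j)) ^ 2 - 1)) := by
    intro b
    rw [← Real.exp_sum, ← Finset.mul_sum, distortion]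
    congr 1; ring
  have h2 : 400 * l ^ 2 / m = m * (400 * (l / m) ^ 2) := by field_simp
  simp_rw [h1, h2]
  exact h

theorem sum_distortion_pow_le {ι : Type*} [Fintype ι] [DecidableEq ι] (m p : ℕ) (x : ι → ℝ)
    (hx : ∑ i, x i ^ 2 = 1) {l : ℝ} (hl0 : 0 < l) (hl : l ≤ m / 8) :
    ∑ b : Fin m → ι → Bool, (distortion x fun p => boolSign (b p.1 p.2)) ^ (2 * p) ≤
      (2 ^ Fintype.card ι) ^ m * (2 * (2 * p / l) ^ (2 * p) * Real.exp (400 * l ^ 2 / m)) := by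
  have h1 := sum_exp_distortion_le m x hx (l := l) (by rwa [abs_of_pos hl0])
  have h2 := sum_exp_distortion_le m x hx (l := -l) (by rwa [abs_neg, abs_of_pos hl0])
  rw [neg_sq] at h2
  have key : ∀ X : ℝ, X ^ (2 * p) ≤
      (2 * p / l) ^ (2 * p) * (Real.exp (l * X) + Real.exp (-l * X)) := by
    intro X
    have h3 := Real.pow_div_factorial_le_exp |l * X| (abs_nonneg _) (2 * p)
    have h4 : Real.exp |l * X| ≤ Real.exp (l * X) + Real.exp (-l * X) := by
      rcases abs_choice (l * X) with h | h <;> rw [h]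
      · linarith [Real.exp_pos (-l * X)]
      · rw [neg_mul]; linarith [Real.exp_pos (l * X)]
    have h5 : ((2 * p).factorial : ℝ) ≤ (2 * p) ^ (2 * p) := by
      exact_mod_cast Nat.factorial_le_pow (2 * p)
    rw [div_le_iff₀ (by positivity), (even_two_mul p).pow_abs, mul_pow] at h3
    rw [div_pow, div_mul_eq_mul_div, le_div_iff₀ (by positivity), mul_comm (X ^ _)]
    refine h3.trans ?_
    rw [mul_comm]
    gcongr
  calc _ ≤ ∑ b : Fin m → ι → Bool, (2 * p / l) ^ (2 * p) *
        (Real.exp (l * distortion x fun p => boolSign (b p.1 p.2)) +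
          Real.exp (-l * distortion x fun p => boolSign (b p.1 p.2))) :=
        Finset.sum_le_sum fun b _ => key _
    _ = (2 * p / l) ^ (2 * p) *
        (∑ b : Fin m → ι → Bool, Real.exp (l * distortion x fun p => boolSign (b p.1 p.2)) +
          ∑ b : Fin m → ι → Bool,
            Real.exp (-l * distortion x fun p => boolSign (b p.1 p.2))) := by
        rw [← Finset.mul_sum, Finset.sum_add_distrib]
    _ ≤ (2 * p / l) ^ (2 * p) * ((2 ^ Fintype.card ι) ^ m * Real.exp (400 * l ^ 2 / m) +
          (2 ^ Fintype.card ι) ^ m * Real.exp (400 * l ^ 2 / m)) := by gcongr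
    _ = _ := by ring

namespace IsSignDesign

variable {Ω ι : Type*} [Fintype Ω] [Fintype ι]

theorem sum_distortion_pow_le {m p : ℕ} {s : Ω → Fin m × ι → ℝ} (h : IsSignDesign (4 * p) s)
    (x : ι → ℝ) (hx : ∑ i, x i ^ 2 = 1) {l : ℝ} (hl0 : 0 < l) (hl : l ≤ m / 8) :
    ∑ ω, distortion x (s ω) ^ (2 * p) ≤
      Fintype.card Ω * (2 * (2 * p / l) ^ (2 * p) * Real.exp (400 * l ^ 2 / m)) := by
  classical
  let P : MvPolynomial (Fin m × ι) ℝ :=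
    (MvPolynomial.C ((m : ℝ)⁻¹) *
      ∑ i, ((∑ j, MvPolynomial.C (x j) * MvPolynomial.X (i, j)) ^ 2 - 1)) ^ (2 * p)
  have hdeg : P.totalDegree ≤ 4 * p := by
    have hlin : ∀ i : Fin m, (∑ j, MvPolynomial.C (x j) *
        (MvPolynomial.X (i, j) : MvPolynomial (Fin m × ι) ℝ)).totalDegree ≤ 1 := by
      intro i
      refine MvPolynomial.totalDegree_finsetSum_le fun j _ => ?_
      refine (MvPolynomial.totalDegree_mul _ _).trans ?_
      simp
    refine (MvPolynomial.totalDegree_pow _ _).trans ?_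
    have : (MvPolynomial.C ((m : ℝ)⁻¹) * ∑ i : Fin m, ((∑ j, MvPolynomial.C (x j) *
        (MvPolynomial.X (i, j) : MvPolynomial (Fin m × ι) ℝ)) ^ 2 - 1)).totalDegree ≤ 2 := by
      refine (MvPolynomial.totalDegree_mul _ _).trans ?_
      rw [MvPolynomial.totalDegree_C, zero_add]
      refine MvPolynomial.totalDegree_finsetSum_le fun i _ => ?_
      refine (MvPolynomial.totalDegree_sub _ _).trans (max_le ?_ (by simp))
      exact (MvPolynomial.totalDegree_pow _ _).trans (by have := hlin i; omega)
    calc _ ≤ 2 * p * 2 := Nat.mul_le_mul_left _ this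
      _ = 4 * p := by ring
  have heval : ∀ σ : Fin m × ι → ℝ, MvPolynomial.eval σ P = distortion x σ ^ (2 * p) := by
    intro σ
    simp only [P, map_pow, map_mul, map_sum, map_sub, map_one, MvPolynomial.eval_C,
      MvPolynomial.eval_X, distortion]
    ring
  have hfull := (isSignDesign_boolSign (ι := Fin m × ι) (4 * p)).comp_equiv
    (Equiv.curry (Fin m) ι Bool).symm
  have heq := h.card_mul_sum_eval hfull P hdeg
  simp_rw [heval] at heq
  have hb := _root_.sum_distortion_pow_le m p x hx hl0 hl
  have hcard : (Fintype.card (Fin m → ι → Bool) : ℝ) = (2 ^ Fintype.card ι) ^ m := by simp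
  rw [hcard] at heq
  have hpos : (0 : ℝ) < (2 ^ Fintype.card ι) ^ m := by positivity
  refine le_of_mul_le_mul_left ?_ hpos
  rw [heq, mul_left_comm]
  exact mul_le_mul_of_nonneg_left hb (Nat.cast_nonneg _)

open Classical in
theorem card_lt_abs_distortion_le {m p : ℕ} {s : Ω → Fin m × ι → ℝ}
    (h : IsSignDesign (4 * p) s) (hp : 0 < p) {ε : ℝ} (hε : 0 < ε) (hε2 : ε ≤ 2)
    (hm : 14400 * p ≤ ε ^ 2 * m) (x : ι → ℝ) (hx : ∑ i, x i ^ 2 = 1) :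
    ((Finset.univ.filter fun ω => ε < |distortion x (s ω)|).card : ℝ) ≤
      Fintype.card Ω * (2 * Real.exp (-p)) := by
  have hp' : (0 : ℝ) < p := by exact_mod_cast hp
  have hm' : (0 : ℝ) < m := by
    by_contra hcon
    have := mul_nonpos_of_nonneg_of_nonpos (sq_nonneg ε) (not_lt.mp hcon)
    linarith
  have hl : 6 * p / ε ≤ (m : ℝ) / 8 := by
    rw [div_le_div_iff₀ hε (by norm_num)]
    nlinarith [mul_pos hε hm']
  have hb := h.sum_distortion_pow_le x hx (l := 6 * p / ε) (by positivity) hl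
  have hε' : 0 < ε ^ (2 * p) := by positivity
  have h1 : ((Finset.univ.filter fun ω => ε < |distortion x (s ω)|).card : ℝ) * ε ^ (2 * p) ≤
      ∑ ω, distortion x (s ω) ^ (2 * p) := by
    rw [← nsmul_eq_mul, ← Finset.sum_const]
    refine (Finset.sum_le_sum fun ω hω => ?_).trans
      (Finset.sum_le_sum_of_subset_of_nonneg (Finset.filter_subset _ _)
        fun ω _ _ => (even_two_mul p).pow_nonneg _)
    rw [← (even_two_mul p).pow_abs (distortion x (s ω))]
    exact pow_le_pow_left₀ hε.le (Finset.mem_filter.mp hω).2.le _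
  have h2 : (2 * p / (6 * p / ε) : ℝ) ^ (2 * p) = (1 / 9) ^ p * ε ^ (2 * p) := by
    rw [show (2 * p / (6 * p / ε) : ℝ) = 1 / 3 * ε by field_simp; norm_num, mul_pow, pow_mul]
    norm_num
  have h3 : 400 * (6 * p / ε) ^ 2 / m ≤ (p : ℝ) := by
    rw [div_pow, mul_div_assoc', div_div, div_le_iff₀ (by positivity)]
    nlinarith
  have h4 : (1 / 9 : ℝ) ^ p ≤ Real.exp (-p) * Real.exp (-p) := by
    rw [← Real.exp_add, show (-p + -p : ℝ) = p * (-2) by ring, Real.exp_nat_mul]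
    refine pow_le_pow_left₀ (by norm_num) ?_ _
    rw [Real.exp_neg, one_div]
    refine inv_anti₀ (Real.exp_pos _) ?_
    have := Real.exp_one_lt_d9
    rw [show (2 : ℝ) = 1 + 1 by norm_num, Real.exp_add]
    nlinarith [Real.exp_pos 1]
  refine le_of_mul_le_mul_right ((h1.trans hb).trans ?_) hε'
  rw [h2]
  calc (Fintype.card Ω : ℝ) * (2 * ((1 / 9) ^ p * ε ^ (2 * p)) *
        Real.exp (400 * (6 * p / ε) ^ 2 / m))
      ≤ Fintype.card Ω * (2 * (Real.exp (-p) * Real.exp (-p) * ε ^ (2 * p)) * Real.exp p) := by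
        gcongr
    _ = Fintype.card Ω * (2 * (Real.exp (-p) * (Real.exp (-p) * Real.exp p) * ε ^ (2 * p))) := by
        ring
    _ = _ := by rw [← Real.exp_add, neg_add_cancel, Real.exp_zero]; ring

open Classical in
theorem card_norm_sq_distorted_le {m p : ℕ} {s : Ω → Fin m × ι → ℝ}
    (h : IsSignDesign (4 * p) s) (hp : 0 < p) {ε : ℝ} (hε : 0 < ε) (hε2 : ε ≤ 2)
    (hm : 14400 * p ≤ ε ^ 2 * m) (z : ι → ℝ) :
    ((Finset.univ.filter fun ω => ε * ∑ j, z j ^ 2 <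
        |∑ i, (∑ j, s ω (i, j) / √m * z j) ^ 2 - ∑ j, z j ^ 2|).card : ℝ) ≤
      Fintype.card Ω * (2 * Real.exp (-p)) := by
  have hm' : (m : ℝ) ≠ 0 := by
    rintro h0
    have hp' : (0 : ℝ) < p := by exact_mod_cast hp
    rw [h0] at hm
    linarith
  rcases (Finset.sum_nonneg fun j _ => sq_nonneg (z j) : 0 ≤ ∑ j, z j ^ 2).eq_or_lt with h0 | hpos
  · have hz : ∀ j, z j = 0 := fun j => by
      have := (Finset.sum_eq_zero_iff_of_nonneg fun j _ => sq_nonneg (z j)).mp h0.symm j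
        (Finset.mem_univ j)
      simpa using this
    simp only [hz]
    simp
    positivity
  set q := ∑ j, z j ^ 2 with hq
  have hsq : √q ^ 2 = q := Real.sq_sqrt hpos.le
  have hx : ∑ j, (z j / √q) ^ 2 = 1 := by
    simp_rw [div_pow, hsq, ← Finset.sum_div]
    exact div_self hpos.ne'
  refine le_trans ?_ (h.card_lt_abs_distortion_le hp hε hε2 hm _ hx)
  refine Nat.cast_le.mpr (Finset.card_le_card (Finset.monotone_filter_right _ fun ω _ hω => ?_))
  have hD : ∑ i, (∑ j, s ω (i, j) / √m * z j) ^ 2 - q =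
      distortion (fun j => z j / √q) (s ω) * q := by
    have h1 : ∀ i, (∑ j, s ω (i, j) / √m * z j) ^ 2 =
        (∑ j, z j / √q * s ω (i, j)) ^ 2 * (q / m) := by
      intro i
      have hq0 : √q ≠ 0 := (Real.sqrt_pos.mpr hpos).ne'
      rw [show ∑ j, s ω (i, j) / √m * z j = (∑ j, z j / √q * s ω (i, j)) * (√q / √m) by
        rw [Finset.sum_mul]
        refine Finset.sum_congr rfl fun j _ => ?_
        field_simp, mul_pow, div_pow, hsq, Real.sq_sqrt (Nat.cast_nonneg _)]
    simp_rw [h1, ← Finset.sum_mul]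
    rw [distortion, Finset.sum_sub_distrib]
    simp only [Finset.sum_const, Finset.card_univ, Fintype.card_fin, nsmul_eq_mul, mul_one]
    field_simp
  rw [hD, abs_mul, abs_of_pos hpos] at hω
  exact lt_of_mul_lt_mul_right hω hpos.le

end IsSignDesign

theorem uniformCount_toReal {α : Type*} [Fintype α] [MeasurableSpace α]
    [MeasurableSingletonClass α] (S : Finset α) :
    (uniformCount α S).toReal = S.card / Fintype.card α := by
  rw [uniformCount, Measure.smul_apply, Measure.count_apply_finset, smul_eq_mul,
    ENNReal.toReal_mul, ENNReal.toReal_inv, Nat.card_eq_fintype_card]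
  simp only [ENNReal.toReal_natCast]
  ring

/-- Design parameters for dimension `d`: number `p` controlling the moment `2 * p`, number of
rows `m` and number of bits `r` per field element, with explicit bounds. -/
theorem exists_parameters {γ : ℝ} (hγ : 1 ≤ γ) {M : ℝ} (hM : M = 43200 * γ + 8) {d : ℕ}
    (hd : 2 ≤ d) :
    ∃ p m r : ℕ, 0 < p ∧ γ * Real.log d ≤ p ∧ r ≠ 0 ∧ m * d ≤ 2 ^ r ∧
      14400 * p ≤ (1 / Real.log d) ^ 2 * m ∧ (m : ℝ) ≤ M * Real.log d ^ 3 ∧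
      ((r * (4 * p) : ℕ) : ℝ) ≤ (10 + 4 * Real.log M) * (12 * γ) * Real.log d ^ 2 := by
  set L := Real.log d with hLdef
  have hd0 : (0 : ℝ) < d := by exact_mod_cast (by omega : 0 < d)
  have hl2 : 1 / 2 < Real.log 2 := by linarith [Real.log_two_gt_d9]
  have hL : 1 / 2 < L :=
    hl2.trans_le (Real.log_le_log (by norm_num) (by exact_mod_cast hd))
  have hL0 : 0 < L := by linarith
  have hγL : 1 / 2 < γ * L := by nlinarith
  have hp1 : γ * L ≤ ⌈γ * L⌉₊ := Nat.le_ceil _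
  have hp2 : (⌈γ * L⌉₊ : ℝ) ≤ 3 * γ * L := by
    have := Nat.ceil_lt_add_one (a := γ * L) (by linarith)
    linarith
  set p := ⌈γ * L⌉₊
  have hp0 : (0 : ℝ) < p := by linarith
  have hm1 : 14400 * p * L ^ 2 ≤ ⌈14400 * p * L ^ 2⌉₊ := Nat.le_ceil _
  have hm2 : (⌈14400 * p * L ^ 2⌉₊ : ℝ) ≤ M * L ^ 3 := by
    have h1 := Nat.ceil_lt_add_one (a := 14400 * p * L ^ 2) (by positivity)
    have h2 : 14400 * p * L ^ 2 ≤ 14400 * (3 * γ * L) * L ^ 2 := by gcongr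
    have h3 : (1 / 2 : ℝ) ^ 3 ≤ L ^ 3 := by gcongr
    rw [hM]
    nlinarith
  set m := ⌈14400 * p * L ^ 2⌉₊
  have hM1 : 1 < M := by rw [hM]; linarith
  have hlM : 0 < Real.log M := Real.log_pos hM1
  have hr1 : (4 * L + Real.log M) / Real.log 2 ≤ ⌈(4 * L + Real.log M) / Real.log 2⌉₊ :=
    Nat.le_ceil _
  have hrpos : 0 < (4 * L + Real.log M) / Real.log 2 := by positivity
  have hr2 : (⌈(4 * L + Real.log M) / Real.log 2⌉₊ : ℝ) ≤ (10 + 4 * Real.log M) * L := by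
    have h1 := Nat.ceil_lt_add_one hrpos.le
    have h2 : (4 * L + Real.log M) / Real.log 2 ≤ 2 * (4 * L + Real.log M) := by
      rw [div_le_iff₀ (by linarith)]
      nlinarith
    nlinarith
  set r := ⌈(4 * L + Real.log M) / Real.log 2⌉₊
  refine ⟨p, m, r, by exact_mod_cast hp0, hp1, (Nat.ceil_pos.mpr hrpos).ne', ?_, ?_, hm2, ?_⟩
  · have h1 : (m * d : ℝ) ≤ 2 ^ r := by
      calc (m * d : ℝ) ≤ M * L ^ 3 * d := by gcongr
        _ ≤ M * Real.exp L ^ 3 * d := by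
          gcongr
          linarith [Real.add_one_le_exp L]
        _ = Real.exp (4 * L + Real.log M) := by
          rw [Real.exp_add, Real.exp_log (zero_lt_one.trans hM1), show 4 * L = (3 : ℕ) * L + L by
            push_cast; ring, Real.exp_add, Real.exp_nat_mul, hLdef, Real.exp_log hd0]
          ring
        _ ≤ Real.exp (r * Real.log 2) := by
          rw [div_le_iff₀ (by linarith)] at hr1
          gcongr
        _ = 2 ^ r := by rw [Real.exp_nat_mul, Real.exp_log (by norm_num)]
    exact_mod_cast h1
  · rw [div_pow, one_pow, div_mul_eq_mul_div, one_mul, le_div_iff₀ (by positivity)]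
    exact hm1
  · push_cast
    calc (r : ℝ) * (4 * p) ≤ (10 + 4 * Real.log M) * L * (4 * (3 * γ * L)) := by gcongr
      _ = _ := by ring

/-- Kane–Nelson low-randomness Johnson–Lindenstrauss transform: for every `γ ≥ 1` there are
constants `C(γ), C'(γ) > 0` such that for every `d ≥ 2` there are `m ≤ C(ln d)³`,
`k ≤ C(ln d)²`, and a family of `m × d` matrices `Z_ω` indexed by `k` random bits, such that
for every pair of unit vectors `x, y ∈ S^{d−1}`, with probability at least `1 − C'·d^{−γ}`
over uniform `ω ∈ {0,1}^k`, the matrix `Z_ω` preserves the squared norms of `x`, `y`, and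
`x − y` up to factor `1 ± 1/ln d`. -/
theorem stmt_13 (γ : ℝ) (hγ : 1 ≤ γ) :
    ∃ C : ℝ, 0 < C ∧ ∃ C' : ℝ, 0 < C' ∧
      ∀ d : ℕ, 2 ≤ d →
        ∃ (m k : ℕ) (Z : (Fin k → Bool) → Fin m → Fin d → ℝ),
          (m : ℝ) ≤ C * (Real.log d) ^ 3 ∧ (k : ℝ) ≤ C * (Real.log d) ^ 2 ∧
          ∀ x y : EuclideanSpace ℝ (Fin d), ‖x‖ = 1 → ‖y‖ = 1 →
            1 - C' * (d : ℝ) ^ (-γ) ≤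
              ((uniformCount (Fin k → Bool))
                {ω | (1 - 1 / Real.log d ≤ ∑ i, (∑ j, Z ω i j * x j) ^ 2 ∧
                        ∑ i, (∑ j, Z ω i j * x j) ^ 2 ≤ 1 + 1 / Real.log d) ∧
                     (1 - 1 / Real.log d ≤ ∑ i, (∑ j, Z ω i j * y j) ^ 2 ∧
                        ∑ i, (∑ j, Z ω i j * y j) ^ 2 ≤ 1 + 1 / Real.log d) ∧
                     ((1 - 1 / Real.log d) * ‖x - y‖ ^ 2 ≤
                          ∑ i, (∑ j, Z ω i j * (x j - y j)) ^ 2 ∧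
                        ∑ i, (∑ j, Z ω i j * (x j - y j)) ^ 2 ≤
                          (1 + 1 / Real.log d) * ‖x - y‖ ^ 2)}).toReal := by
  classical
  set M := 43200 * γ + 8 with hM
  have hlM : 0 < Real.log M := Real.log_pos (by linarith)
  have hC2 : 0 < (10 + 4 * Real.log M) * (12 * γ) := by positivity
  refine ⟨M + (10 + 4 * Real.log M) * (12 * γ), by positivity, 6, by norm_num, fun d hd => ?_⟩
  obtain ⟨p, m, r, hp, hγp, hr, hmd, hm, hmM, hk⟩ := exists_parameters hγ hM hd
  obtain ⟨s, hs⟩ := exists_isSignDesign (ι := Fin m × Fin d) r (4 * p) hr (by simpa using hmd)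
  have hd0 : (0 : ℝ) < d := by exact_mod_cast (by omega : 0 < d)
  have hL : 1 / 2 < Real.log d := by
    have h2 : Real.log 2 ≤ Real.log d := Real.log_le_log (by norm_num) (by exact_mod_cast hd)
    linarith [Real.log_two_gt_d9]
  have hL0 : 0 < Real.log d := by linarith
  refine ⟨m, r * (4 * p), fun ω i j => s ω (i, j) / √m, hmM.trans ?_, hk.trans ?_,
    fun x y hx hy => ?_⟩
  · gcongr; linarith
  · gcongr; linarith
  have hε2 : 1 / Real.log d ≤ 2 := by rw [div_le_iff₀ hL0]; linarith
  have bad := hs.card_norm_sq_distorted_le hp (one_div_pos.mpr hL0) hε2 hm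
  set ε := 1 / Real.log d
  set B : (Fin d → ℝ) → Finset (Fin (r * (4 * p)) → Bool) := fun z =>
    Finset.univ.filter fun ω => ε * ∑ j, z j ^ 2 <
        |∑ i, (∑ j, s ω (i, j) / √m * z j) ^ 2 - ∑ j, z j ^ 2|
  have hgood : ∀ z ω, ω ∉ B z →
      (1 - ε) * ∑ j, z j ^ 2 ≤ ∑ i, (∑ j, s ω (i, j) / √m * z j) ^ 2 ∧
        ∑ i, (∑ j, s ω (i, j) / √m * z j) ^ 2 ≤ (1 + ε) * ∑ j, z j ^ 2 := by
    intro z ω hω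
    simp only [B, Finset.mem_filter, Finset.mem_univ, true_and, not_lt] at hω
    have := abs_le.mp hω
    constructor <;> linarith [this.1, this.2]
  have hnx : ∑ j, x j ^ 2 = 1 := by rw [← EuclideanSpace.real_norm_sq_eq, hx, one_pow]
  have hny : ∑ j, y j ^ 2 = 1 := by rw [← EuclideanSpace.real_norm_sq_eq, hy, one_pow]
  have hnxy : ∑ j, (x j - y j) ^ 2 = ‖x - y‖ ^ 2 := by
    rw [EuclideanSpace.real_norm_sq_eq]; simp
  set U := B x ∪ B y ∪ B fun j => x j - y j with hU
  have hcardU : (U.card : ℝ) ≤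
      Fintype.card (Fin (r * (4 * p)) → Bool) * (6 * Real.exp (-p)) := by
    have h1 : (U.card : ℝ) ≤ (B x).card + (B y).card + (B fun j => x j - y j).card := by
      exact_mod_cast (Finset.card_union_le _ _).trans
        (Nat.add_le_add_right (Finset.card_union_le _ _) _)
    linarith [bad x, bad y, bad fun j => x j - y j]
  have hN : (0 : ℝ) < Fintype.card (Fin (r * (4 * p)) → Bool) := by
    exact_mod_cast Fintype.card_pos
  have hexp : Real.exp (-p) ≤ (d : ℝ) ^ (-γ) := by
    rw [Real.rpow_def_of_pos hd0]
    apply Real.exp_le_exp.mpr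
    linarith
  calc 1 - 6 * (d : ℝ) ^ (-γ) ≤ 1 - 6 * Real.exp (-p) := by linarith
    _ ≤ (uniformCount (Fin (r * (4 * p)) → Bool) ↑Uᶜ).toReal := by
      rw [uniformCount_toReal, le_div_iff₀ hN, Finset.card_compl,
        Nat.cast_sub (Finset.card_le_univ _)]
      linarith
    _ ≤ _ := by
      refine ENNReal.toReal_mono ?_ (measure_mono fun ω hω => ?_)
      · refine ne_top_of_le_ne_top ?_ (measure_mono (Set.subset_univ _))
        rw [uniformCount, Measure.smul_apply, Measure.count_univ, smul_eq_mul]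
        refine ENNReal.mul_ne_top (ENNReal.inv_ne_top.mpr ?_) ?_
        · simp
        · simp
      · simp only [hU, Finset.coe_compl, Set.mem_compl_iff, Finset.mem_coe, Finset.mem_union,
          not_or] at hω
        have h1 := hgood _ _ hω.1.1
        have h2 := hgood _ _ hω.1.2
        have h3 := hgood _ _ hω.2
        rw [hnx, mul_one, mul_one] at h1
        rw [hny, mul_one, mul_one] at h2
        rw [hnxy] at h3
        exact ⟨h1, h2, h3⟩
end

section
/- For every C₁ > 0 there exist a constant C₂ = C₂(C₁) > 0 and a threshold d₀ = d₀(C₁) such that the following holds for all d ≥ d₀. Let m and d' be integers with m ≤ C₁ (ln d)^4 and m ≤ d' ≤ d, and let x̃, ỹ ∈ ℝ^m be nonzero vectors. Let G' ∈ ℝ^{d'×m} have i.i.d. N(0,1) entries and let Ĝ ∈ ℝ^{d'×m} have i.i.d. entries distributed as a real random variable X whose CDF F_X satisfies sup_{t∈ℝ} |F_X(t) − Φ(t)| ≤ d^{−ln d}. Then | Pr[h_{Ĝ}(x̃) = h_{Ĝ}(ỹ)] − Pr[h_{G'}(x̃) = h_{G'}(ỹ)] | ≤ C₂ · d^{3 −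 ln d}. -/
open MeasureTheory ProbabilityTheory

/-- The law of a `k × m` matrix with i.i.d. standard Gaussian entries. -/
noncomputable def gaussMatrix (k m : ℕ) : Measure (Fin k → Fin m → ℝ) :=
  Measure.pi fun _ => Measure.pi fun _ => gaussianReal 0 1

/-- `(Av)_i` for a matrix `A` given by rows and a vector `v`. -/
def mvMul {k m : ℕ} (A : Fin k → Fin m → ℝ) (v : Fin m → ℝ) (i : Fin k) : ℝ :=
  ∑ j, A i j * v j

/-- The event that `v` cross-polytope hashes to `s·e_i` under `A`, via strict inequalities. -/
def hashAt {k m : ℕ} (A : Fin k → Fin m → ℝ) (v : Fin m → ℝ) (i : Fin k) (s : ℝ) : Prop :=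
  ∀ j, j ≠ i → |mvMul A v j| < s * mvMul A v i

/-- The event that `v` and `w` receive the same cross-polytope hash under `A`. -/
def collide {k m : ℕ} (A : Fin k → Fin m → ℝ) (v w : Fin m → ℝ) : Prop :=
  ∃ (i : Fin k) (s : ℝ), (s = 1 ∨ s = -1) ∧ hashAt A v i s ∧ hashAt A w i s

/-- The standard Gaussian cumulative distribution function. -/
noncomputable def Phi (x : ℝ) : ℝ := ((gaussianReal 0 1) (Set.Iic x)).toReal

open Set Filter Topology

/-- CDFs that are uniformly `ε`-close have `ε`-close left limits. -/
lemma abs_measureReal_Iio_sub_le {μ ν : Measure ℝ} [IsProbabilityMeasure μ]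
    [IsProbabilityMeasure ν] {ε : ℝ} (h : ∀ t, |μ.real (Iic t) - ν.real (Iic t)| ≤ ε) (t : ℝ) :
    |μ.real (Iio t) - ν.real (Iio t)| ≤ ε := by
  obtain ⟨u, hu, hut, hlim⟩ := exists_seq_strictMono_tendsto t
  have key (ρ : Measure ℝ) [IsProbabilityMeasure ρ] :
      Tendsto (fun n => ρ.real (Iic (u n))) atTop (𝓝 (ρ.real (Iio t))) := by
    rw [← iUnion_Iic_eq_Iio_of_lt_of_tendsto hut hlim]
    exact (ENNReal.tendsto_toReal (measure_ne_top _ _)).comp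
      (tendsto_measure_iUnion_atTop fun _ _ hab => Iic_subset_Iic.2 (hu.monotone hab))
  exact le_of_tendsto ((key μ).sub (key ν)).abs (Eventually.of_forall fun n => h (u n))

lemma IsLowerSet.eq_empty_or_univ_or_Iio_or_Iic {L : Set ℝ} (hL : IsLowerSet L) :
    L = ∅ ∨ L = univ ∨ ∃ a, L = Iio a ∨ L = Iic a := by
  rcases L.eq_empty_or_nonempty with h | hne
  · exact Or.inl h
  by_cases hb : BddAbove L
  · refine Or.inr (Or.inr ⟨sSup L, ?_⟩)
    have hlt : Iio (sSup L) ⊆ L := fun x hx => by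
      obtain ⟨y, hy, hxy⟩ := exists_lt_of_lt_csSup hne hx
      exact hL hxy.le hy
    by_cases hs : sSup L ∈ L
    · exact Or.inr (Subset.antisymm (fun x hx => le_csSup hb hx) fun x hx => hL hx hs)
    · refine Or.inl (Subset.antisymm (fun x hx => ?_) hlt)
      exact lt_of_le_of_ne (le_csSup hb hx) fun h => hs (h ▸ hx)
  · refine Or.inr (Or.inl (eq_univ_of_forall fun x => ?_))
    obtain ⟨y, hy, hxy⟩ := not_bddAbove_iff.1 hb x
    exact hL hxy.le hy

lemma IsLowerSet.measurableSet_real {L : Set ℝ} (hL : IsLowerSet L) : MeasurableSet L := by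
  rcases hL.eq_empty_or_univ_or_Iio_or_Iic with rfl | rfl | ⟨a, rfl | rfl⟩ <;> measurability

lemma IsLowerSet.abs_measureReal_sub_le {μ ν : Measure ℝ} [IsProbabilityMeasure μ]
    [IsProbabilityMeasure ν] {ε : ℝ} (h : ∀ t, |μ.real (Iic t) - ν.real (Iic t)| ≤ ε)
    {L : Set ℝ} (hL : IsLowerSet L) : |μ.real L - ν.real L| ≤ ε := by
  have hε : 0 ≤ ε := (abs_nonneg _).trans (h 0)
  rcases hL.eq_empty_or_univ_or_Iio_or_Iic with rfl | rfl | ⟨a, rfl | rfl⟩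
  · simpa using hε
  · simpa using hε
  · exact abs_measureReal_Iio_sub_le h a
  · exact h a

/-- CDFs that are uniformly `ε`-close give `2ε`-close masses to every interval. -/
lemma Set.OrdConnected.abs_measureReal_sub_le {μ ν : Measure ℝ} [IsProbabilityMeasure μ]
    [IsProbabilityMeasure ν] {ε : ℝ} (h : ∀ t, |μ.real (Iic t) - ν.real (Iic t)| ≤ ε)
    {S : Set ℝ} (hS : S.OrdConnected) : |μ.real S - ν.real S| ≤ 2 * ε := by
  have hε : 0 ≤ ε := (abs_nonneg _).trans (h 0)
  rcases S.eq_empty_or_nonempty with rfl | ⟨s, hs⟩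
  · simpa using hε
  let L : Set ℝ := {x | ∃ s ∈ S, x ≤ s}
  let K : Set ℝ := {x | ∀ s ∈ S, x < s}
  have hL : IsLowerSet L := fun a b hab ⟨s, hs, h⟩ => ⟨s, hs, hab.trans h⟩
  have hK : IsLowerSet K := fun a b hab h s hs => hab.trans_lt (h s hs)
  have hKL : K ⊆ L := fun x hx => ⟨s, hs, (hx s hs).le⟩
  have hSe : S = L \ K := by
    ext x
    constructor
    · exact fun hx => ⟨⟨x, hx, le_rfl⟩, fun hk => (hk x hx).false⟩
    · rintro ⟨⟨b, hb, hxb⟩, hk⟩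
      simp only [K, mem_ofPred_eq, not_forall, not_lt] at hk
      obtain ⟨a, ha, hax⟩ := hk
      exact hS.out ha hb ⟨hax, hxb⟩
  rw [hSe, measureReal_sdiff hKL hK.measurableSet_real, measureReal_sdiff hKL hK.measurableSet_real]
  have h₁ := abs_le.1 (hL.abs_measureReal_sub_le h)
  have h₂ := abs_le.1 (hK.abs_measureReal_sub_le h)
  rw [abs_le]
  constructor <;> linarith [h₁.1, h₁.2, h₂.1, h₂.2]

lemma integrable_measureReal_of_measurable {α β : Type*} [MeasurableSpace α] [MeasurableSpace β]
    (μ : Measure α) [IsProbabilityMeasure μ] (ν : Measure β) [IsProbabilityMeasure ν]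
    {f : α → Set β} (hf : Measurable fun x => ν (f x)) : Integrable (fun x => ν.real (f x)) μ :=
  Integrable.of_bound hf.ennreal_toReal.aestronglyMeasurable 1
    (Eventually.of_forall fun x => by
      rw [Real.norm_of_nonneg measureReal_nonneg]; exact measureReal_le_one)

lemma abs_integral_measureReal_sub_le {α β : Type*} [MeasurableSpace α] [MeasurableSpace β]
    (μ : Measure α) [IsProbabilityMeasure μ] (ν₁ ν₂ : Measure β) [IsProbabilityMeasure ν₁]
    [IsProbabilityMeasure ν₂] {f : α → Set β} (hf₁ : Measurable fun x => ν₁ (f x))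
    (hf₂ : Measurable fun x => ν₂ (f x)) {ε : ℝ}
    (h : ∀ x, |ν₁.real (f x) - ν₂.real (f x)| ≤ ε) :
    |∫ x, ν₁.real (f x) ∂μ - ∫ x, ν₂.real (f x) ∂μ| ≤ ε := by
  rw [← integral_sub (integrable_measureReal_of_measurable μ ν₁ hf₁)
    (integrable_measureReal_of_measurable μ ν₂ hf₂)]
  simpa using norm_integral_le_of_norm_le_const (μ := μ)
    (f := fun x => ν₁.real (f x) - ν₂.real (f x)) (Eventually.of_forall h)

lemma measureReal_prod_eq_integral {α β : Type*} [MeasurableSpace α] [MeasurableSpace β]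
    (μ : Measure α) [IsProbabilityMeasure μ] (ν : Measure β) [IsProbabilityMeasure ν]
    {S : Set (α × β)} (hS : MeasurableSet S) :
    (μ.prod ν).real S = ∫ x, ν.real (Prod.mk x ⁻¹' S) ∂μ := by
  simp only [measureReal_def]
  rw [Measure.prod_apply hS, integral_toReal (measurable_measure_prodMk_left hS).aemeasurable
    (Eventually.of_forall fun _ => measure_lt_top _ _)]

lemma measureReal_prod_eq_integral_symm {α β : Type*} [MeasurableSpace α] [MeasurableSpace β]
    (μ : Measure α) [IsProbabilityMeasure μ] (ν : Measure β) [IsProbabilityMeasure ν]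
    {S : Set (α × β)} (hS : MeasurableSet S) :
    (μ.prod ν).real S = ∫ y, μ.real ((fun x => (x, y)) ⁻¹' S) ∂ν := by
  simp only [measureReal_def]
  rw [Measure.prod_apply_symm hS,
    integral_toReal (measurable_measure_prodMk_right hS).aemeasurable
    (Eventually.of_forall fun _ => measure_lt_top _ _)]

lemma abs_measureReal_prod_sub_le {α β : Type*} [MeasurableSpace α] [MeasurableSpace β]
    {μ₁ μ₂ : Measure α} [IsProbabilityMeasure μ₁] [IsProbabilityMeasure μ₂]
    {ν₁ ν₂ : Measure β} [IsProbabilityMeasure ν₁] [IsProbabilityMeasure ν₂]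
    {S : Set (α × β)} (hS : MeasurableSet S) {a b : ℝ}
    (ha : ∀ y, |μ₁.real ((fun x => (x, y)) ⁻¹' S) - μ₂.real ((fun x => (x, y)) ⁻¹' S)| ≤ a)
    (hb : ∀ x, |ν₁.real (Prod.mk x ⁻¹' S) - ν₂.real (Prod.mk x ⁻¹' S)| ≤ b) :
    |(μ₁.prod ν₁).real S - (μ₂.prod ν₂).real S| ≤ a + b := by
  have h₁ : |(μ₁.prod ν₁).real S - (μ₁.prod ν₂).real S| ≤ b := by
    rw [measureReal_prod_eq_integral _ _ hS, measureReal_prod_eq_integral _ _ hS]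
    exact abs_integral_measureReal_sub_le _ _ _ (measurable_measure_prodMk_left hS)
      (measurable_measure_prodMk_left hS) hb
  have h₂ : |(μ₁.prod ν₂).real S - (μ₂.prod ν₂).real S| ≤ a := by
    rw [measureReal_prod_eq_integral_symm _ _ hS, measureReal_prod_eq_integral_symm _ _ hS]
    exact abs_integral_measureReal_sub_le _ _ _ (measurable_measure_prodMk_right hS)
      (measurable_measure_prodMk_right hS) ha
  linarith [abs_sub_le ((μ₁.prod ν₁).real S) ((μ₁.prod ν₂).real S) ((μ₂.prod ν₂).real S)]

/-- Replacing coordinates one at a time: if exchanging `μ` for `ν` in a single coordinate changes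
the mass of `S` by at most `ε` conditionally on the others, then exchanging it in all `n`
coordinates changes it by at most `n * ε`. -/
lemma abs_measureReal_pi_sub_le {α : Type*} [MeasurableSpace α] {μ ν : Measure α}
    [IsProbabilityMeasure μ] [IsProbabilityMeasure ν] {ε : ℝ} (n : ℕ) {S : Set (Fin n → α)}
    (hS : MeasurableSet S)
    (h : ∀ i x, |μ.real {t | Function.update x i t ∈ S} -
      ν.real {t | Function.update x i t ∈ S}| ≤ ε) :
    |(Measure.pi fun _ : Fin n => μ).real S - (Measure.pi fun _ : Fin n => ν).real S|
      ≤ n * ε := by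
  induction n with
  | zero =>
    rcases Subsingleton.eq_empty_or_singleton (s := S) (subsingleton_of_subsingleton) with
      rfl | ⟨x, rfl⟩
    · simp
    · have hx : ({x} : Set (Fin 0 → α)) = univ := eq_univ_of_forall fun y => Subsingleton.elim y x
      simp [hx]
  | succ n ih =>
    let e := MeasurableEquiv.piFinSuccAbove (fun _ : Fin (n + 1) => α) 0
    have he (ρ : Measure α) [IsProbabilityMeasure ρ] :
        (Measure.pi fun _ : Fin (n + 1) => ρ).real S =
          (ρ.prod (Measure.pi fun _ : Fin n => ρ)).real (e.symm ⁻¹' S) := by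
      have hmp := (measurePreserving_piFinSuccAbove (fun _ : Fin (n + 1) => ρ) 0).symm
      rw [measureReal_def, measureReal_def]
      congr 1
      exact (hmp.measure_preimage hS.nullMeasurableSet).symm
    have hmem (t : α) (x : Fin n → α) : e.symm (t, x) = Fin.cons t x := by
      simp [e, MeasurableEquiv.piFinSuccAbove, Fin.insertNthEquiv]
    rw [he μ, he ν]
    have hSe : MeasurableSet (e.symm ⁻¹' S) := e.symm.measurable hS
    refine (abs_measureReal_prod_sub_le hSe (a := ε) (b := n * ε) (fun y => ?_)
      (fun t => ?_)).trans (by push_cast; linarith)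
    · rcases isEmpty_or_nonempty α with hα | ⟨⟨t₀⟩⟩
      · exact (IsProbabilityMeasure.ne_zero μ (Subsingleton.elim _ _)).elim
      · convert h 0 (Fin.cons t₀ y) using 4 <;> ext t <;> simp [hmem]
    · refine ih (measurable_prodMk_left hSe) fun i x => ?_
      convert h i.succ (Fin.cons t x) using 4 <;> ext u <;> simp [hmem, Fin.cons_update]

lemma measurableSet_hashAt {k m : ℕ} (v : Fin m → ℝ) (i : Fin k) (s : ℝ) :
    MeasurableSet {A : Fin k → Fin m → ℝ | hashAt A v i s} := by
  have hm (j : Fin k) : Measurable fun A : Fin k → Fin m → ℝ => mvMul A v j := by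
    unfold mvMul; fun_prop
  simp only [hashAt, ofPred_forall]
  exact MeasurableSet.iInter fun j => MeasurableSet.iInter fun _ =>
    measurableSet_lt (hm j).abs ((hm i).const_mul s)

lemma measurableSet_collide {k m : ℕ} (v w : Fin m → ℝ) :
    MeasurableSet {A : Fin k → Fin m → ℝ | collide A v w} := by
  have : {A : Fin k → Fin m → ℝ | collide A v w} = ⋃ i, ⋃ s ∈ ({1, -1} : Set ℝ),
      ({A | hashAt A v i s} ∩ {A | hashAt A w i s}) := by
    ext A; simp [collide]
  rw [this]
  exact MeasurableSet.iUnion fun i => Finite.measurableSet_biUnion (by simp) fun s _ =>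
    (measurableSet_hashAt v i s).inter (measurableSet_hashAt w i s)

lemma sign_mul_le_abs {s x : ℝ} (hs : s = 1 ∨ s = -1) : s * x ≤ |x| := by
  rcases hs with rfl | rfl
  · simpa using le_abs_self x
  · simpa using neg_le_abs x

/-- For matrices with at least two rows, the hash value is unique. -/
lemma hashAt_unique {k m : ℕ} (hk : 2 ≤ k) {A : Fin k → Fin m → ℝ} {v : Fin m → ℝ}
    {i i' : Fin k} {s s' : ℝ} (hs : s = 1 ∨ s = -1) (hs' : s' = 1 ∨ s' = -1)
    (h : hashAt A v i s) (h' : hashAt A v i' s') : i = i' ∧ s = s' := by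
  have : Nontrivial (Fin k) := Fin.nontrivial_iff_two_le.2 hk
  have hi : i = i' := by
    by_contra hne
    have h₁ := h i' (Ne.symm hne)
    have h₂ := h' i hne
    linarith [sign_mul_le_abs hs (x := mvMul A v i), sign_mul_le_abs hs' (x := mvMul A v i')]
  subst hi
  obtain ⟨j, hj⟩ := exists_ne i
  have h₁ := (abs_nonneg _).trans_lt (h j hj)
  have h₂ := (abs_nonneg _).trans_lt (h' j hj)
  refine ⟨rfl, ?_⟩
  rcases hs with rfl | rfl <;> rcases hs' with rfl | rfl <;> first | rfl | linarith

/-- Along a line of matrices, each condition "`v` hashes to `s·e_i`" cuts out an interval. -/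
lemma ordConnected_hashAt {k m : ℕ} {A : ℝ → Fin k → Fin m → ℝ} {v : Fin m → ℝ}
    (hA : ∀ j, ∃ a p, ∀ t, mvMul (A t) v j = a + t * p) (i : Fin k) (s : ℝ) :
    {t | hashAt (A t) v i s}.OrdConnected := by
  have : {t | hashAt (A t) v i s} = ⋂ j, ⋂ _ : j ≠ i,
      {t | |mvMul (A t) v j| < s * mvMul (A t) v i} := by
    ext t; simp [hashAt]
  rw [this]
  refine ordConnected_iInter fun j => ordConnected_iInter fun _ => Convex.ordConnected ?_
  obtain ⟨a, p, hap⟩ := hA j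
  obtain ⟨b, q, hbq⟩ := hA i
  simp only [hap, hbq]
  intro t ht u hu α β hα hβ hαβ
  simp only [mem_ofPred_eq, abs_lt, smul_eq_mul] at ht hu ⊢
  obtain rfl : β = 1 - α := by linarith
  rcases hα.eq_or_lt with rfl | hα
  · simpa using hu
  · constructor
    · nlinarith [mul_lt_mul_of_pos_left ht.1 hα, mul_le_mul_of_nonneg_left hu.1.le hβ]
    · nlinarith [mul_lt_mul_of_pos_left ht.2 hα, mul_le_mul_of_nonneg_left hu.2.le hβ]

/-- If only row `i₀` varies along a line of matrices, the parameters for which both vectors hash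
to the same value at a row other than `i₀` form an interval. -/
lemma ordConnected_collide_ne {k m : ℕ} {A : ℝ → Fin k → Fin m → ℝ} {v w : Fin m → ℝ}
    (i₀ : Fin k) (hv : ∀ j, ∃ a p, ∀ t, mvMul (A t) v j = a + t * p)
    (hw : ∀ j, ∃ a p, ∀ t, mvMul (A t) w j = a + t * p)
    (hconst : ∀ j, j ≠ i₀ → ∀ t t', mvMul (A t) v j = mvMul (A t') v j) :
    {t | ∃ i s, i ≠ i₀ ∧ (s = 1 ∨ s = -1) ∧ hashAt (A t) v i s ∧
      hashAt (A t) w i s}.OrdConnected := by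
  refine ⟨?_⟩
  rintro t ⟨i, s, hi, hs, htv, htw⟩ u ⟨i', s', hi', hs', huv, huw⟩ r hr
  have hii : i = i' := by
    by_contra hne
    have h₁ := htv i' (Ne.symm hne)
    have h₂ := huv i hne
    rw [hconst i hi u t, hconst i' hi' u t] at h₂
    linarith [sign_mul_le_abs hs (x := mvMul (A t) v i),
      sign_mul_le_abs hs' (x := mvMul (A t) v i')]
  subst hii
  have hss : s = s' := by
    have h₁ := (abs_nonneg _).trans_lt (htv i₀ hi.symm)
    have h₂ := (abs_nonneg _).trans_lt (huv i₀ hi.symm)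
    rw [hconst i hi u t] at h₂
    rcases hs with rfl | rfl <;> rcases hs' with rfl | rfl <;> first | rfl | linarith
  subst hss
  exact ⟨i, s, hi, hs, (ordConnected_hashAt hv i s).out htv huv hr,
    (ordConnected_hashAt hw i s).out htw huw hr⟩

lemma mvMul_update_of_ne {k m : ℕ} (A : Fin k → Fin m → ℝ) (r v : Fin m → ℝ) {i j : Fin k}
    (hj : j ≠ i) : mvMul (Function.update A i r) v j = mvMul A v j := by
  simp [mvMul, Function.update_of_ne hj]

lemma exists_mvMul_update_update_eq {k m : ℕ} (A : Fin k → Fin m → ℝ) (r v : Fin m → ℝ)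
    (i : Fin k) (l : Fin m) (j : Fin k) :
    ∃ a p, ∀ t, mvMul (Function.update A i (Function.update r l t)) v j = a + t * p := by
  by_cases hj : j = i
  · subst hj
    refine ⟨∑ j ∈ Finset.univ.erase l, r j * v j, v l, fun t => ?_⟩
    rw [mvMul, ← Finset.sum_erase_add _ _ (Finset.mem_univ l)]
    congr 1
    · exact Finset.sum_congr rfl fun x hx => by simp [Finset.ne_of_mem_erase hx]
    · simp
  · exact ⟨mvMul A v j, 0, fun t => by simp [mvMul_update_of_ne A _ v hj]⟩

/-- Exchanging the law of a single matrix entry for one with `ε`-close CDF changes the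
conditional collision probability by at most `6ε`. -/
lemma abs_measureReal_collide_update_sub_le {μ ν : Measure ℝ} [IsProbabilityMeasure μ]
    [IsProbabilityMeasure ν] {ε : ℝ} (h : ∀ t, |μ.real (Iic t) - ν.real (Iic t)| ≤ ε)
    {k m : ℕ} (hk : 2 ≤ k) (v w : Fin m → ℝ) (A : Fin k → Fin m → ℝ) (r : Fin m → ℝ)
    (i : Fin k) (l : Fin m) :
    |μ.real {t | collide (Function.update A i (Function.update r l t)) v w} -
      ν.real {t | collide (Function.update A i (Function.update r l t)) v w}| ≤ 6 * ε := by
  set B : ℝ → Fin k → Fin m → ℝ := fun t => Function.update A i (Function.update r l t) with hB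
  have hv : ∀ j, ∃ a p, ∀ t, mvMul (B t) v j = a + t * p := exists_mvMul_update_update_eq A r v i l
  have hw : ∀ j, ∃ a p, ∀ t, mvMul (B t) w j = a + t * p := exists_mvMul_update_update_eq A r w i l
  let P (s : ℝ) : Set ℝ := {t | hashAt (B t) v i s} ∩ {t | hashAt (B t) w i s}
  let Q : Set ℝ := {t | ∃ j s, j ≠ i ∧ (s = 1 ∨ s = -1) ∧ hashAt (B t) v j s ∧ hashAt (B t) w j s}
  have hP (s : ℝ) : (P s).OrdConnected :=
    (ordConnected_hashAt hv i s).inter (ordConnected_hashAt hw i s)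
  have hQ : Q.OrdConnected := ordConnected_collide_ne i hv hw fun j hj t t' => by
    simp only [hB, mvMul_update_of_ne A _ v hj]
  have hPP : Disjoint (P 1) (P (-1)) := Set.disjoint_left.2 fun t h₁ h₂ => by
    have := (hashAt_unique hk (Or.inl rfl) (Or.inr rfl) h₁.1 h₂.1).2
    norm_num at this
  have hPQ : Disjoint (P 1 ∪ P (-1)) Q := by
    refine Set.disjoint_left.2 ?_
    rintro t (h₁ | h₁) ⟨j, s, hj, hs, h₂, -⟩
    · exact hj (hashAt_unique hk hs (Or.inl rfl) h₂ h₁.1).1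
    · exact hj (hashAt_unique hk hs (Or.inr rfl) h₂ h₁.1).1
  have heq : {t | collide (B t) v w} = (P 1 ∪ P (-1)) ∪ Q := by
    ext t
    constructor
    · rintro ⟨j, s, hs, h₁, h₂⟩
      by_cases hj : j = i
      · subst hj
        rcases hs with rfl | rfl
        · exact Or.inl (Or.inl ⟨h₁, h₂⟩)
        · exact Or.inl (Or.inr ⟨h₁, h₂⟩)
      · exact Or.inr ⟨j, s, hj, hs, h₁, h₂⟩
    · rintro ((h₁ | h₁) | ⟨j, s, -, hs, h₁, h₂⟩)
      · exact ⟨i, 1, Or.inl rfl, h₁.1, h₁.2⟩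
      · exact ⟨i, -1, Or.inr rfl, h₁.1, h₁.2⟩
      · exact ⟨j, s, hs, h₁, h₂⟩
  rw [heq, measureReal_union hPQ hQ.measurableSet, measureReal_union hPQ hQ.measurableSet,
    measureReal_union hPP (hP _).measurableSet, measureReal_union hPP (hP _).measurableSet]
  have h₁ := abs_le.1 ((hP 1).abs_measureReal_sub_le h)
  have h₂ := abs_le.1 ((hP (-1)).abs_measureReal_sub_le h)
  have h₃ := abs_le.1 (hQ.abs_measureReal_sub_le h)
  rw [abs_le]
  constructor <;> linarith [h₁.1, h₁.2, h₂.1, h₂.2, h₃.1, h₃.2]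

/-- Exchanging the law of all matrix entries for one with `ε`-close CDF changes the collision
probability by at most `6kmε`. -/
lemma abs_measureReal_collide_sub_le {μ ν : Measure ℝ} [IsProbabilityMeasure μ]
    [IsProbabilityMeasure ν] {ε : ℝ} (h : ∀ t, |μ.real (Iic t) - ν.real (Iic t)| ≤ ε)
    {k m : ℕ} (v w : Fin m → ℝ) :
    |(Measure.pi fun _ : Fin k => Measure.pi fun _ : Fin m => μ).real {A | collide A v w} -
      (Measure.pi fun _ : Fin k => Measure.pi fun _ : Fin m => ν).real {A | collide A v w}|
      ≤ k * (m * (6 * ε)) := by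
  have hε : 0 ≤ ε := (abs_nonneg _).trans (h 0)
  rcases lt_or_ge k 2 with hk | hk
  · have hk' : k = 0 ∨ k = 1 := by omega
    rcases hk' with rfl | rfl
    · have he : {A : Fin 0 → Fin m → ℝ | collide A v w} = ∅ := by
        ext A; simp [collide]
      simp [he]
    · have he : {A : Fin 1 → Fin m → ℝ | collide A v w} = univ := by
        refine eq_univ_of_forall fun A => ⟨0, 1, Or.inl rfl, ?_, ?_⟩ <;>
          exact fun j hj => (hj (Subsingleton.elim _ _)).elim
      rw [he]
      simp only [probReal_univ, sub_self, abs_zero]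
      positivity
  · refine abs_measureReal_pi_sub_le k (measurableSet_collide v w) fun i A => ?_
    exact abs_measureReal_pi_sub_le m (measurable_update A (measurableSet_collide v w))
      fun l r => abs_measureReal_collide_update_sub_le h hk v w A r i l

/-- Replacing the i.i.d. Gaussian entries of the `d' × m` matrix by i.i.d. entries whose CDF
is within `d^{−ln d}` of the Gaussian CDF changes the cross-polytope collision probability of
any two nonzero vectors in `ℝ^m` by at most `C₂·d^{3−ln d}`, provided `m ≤ C₁(ln d)⁴` and
`m ≤ d' ≤ d` with `d` large enough. -/
theorem stmt_14 (C₁ : ℝ) (hC₁ : 0 < C₁) :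
    ∃ C₂ : ℝ, 0 < C₂ ∧ ∃ d₀ : ℕ, ∀ d : ℕ, d₀ ≤ d →
      ∀ m d' : ℕ, (m : ℝ) ≤ C₁ * (Real.log d) ^ 4 → m ≤ d' → d' ≤ d →
        ∀ xt yt : Fin m → ℝ, xt ≠ 0 → yt ≠ 0 →
          ∀ ν : Measure ℝ, IsProbabilityMeasure ν →
            (∀ t : ℝ, |(ν (Set.Iic t)).toReal - Phi t| ≤ (d : ℝ) ^ (-(Real.log d))) →
            |((Measure.pi fun _ : Fin d' => Measure.pi fun _ : Fin m => ν)
                  {A | collide A xt yt}).toReal -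
                (gaussMatrix d' m {A | collide A xt yt}).toReal|
              ≤ C₂ * (d : ℝ) ^ (3 - Real.log d) := by
  refine ⟨6, by norm_num, 1, fun d hd m d' _ hmd hd'd xt yt _ _ ν _ hν => ?_⟩
  refine (abs_measureReal_collide_sub_le (μ := ν) (ν := gaussianReal 0 1) hν xt yt).trans ?_
  have hd1 : (1 : ℝ) ≤ d := by exact_mod_cast hd
  have hd0 : (0 : ℝ) < d := by linarith
  have hd' : (d' : ℝ) ≤ d := by exact_mod_cast hd'd
  have hm : (m : ℝ) ≤ d := by exact_mod_cast hmd.trans hd'd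
  have hsplit : (d : ℝ) ^ (3 - Real.log d) = d ^ 3 * (d : ℝ) ^ (-Real.log d) := by
    rw [sub_eq_add_neg, Real.rpow_add hd0]
    norm_num
  rw [hsplit]
  have hmul : (d' : ℝ) * m ≤ d ^ 3 :=
    calc (d' : ℝ) * m ≤ d * d := by gcongr
      _ = d ^ 2 := by ring
      _ ≤ d ^ 3 := pow_le_pow_right₀ hd1 (by norm_num)
  have hpos : (0 : ℝ) ≤ (d : ℝ) ^ (-Real.log d) := by positivity
  calc (d' : ℝ) * (m * (6 * (d : ℝ) ^ (-Real.log d)))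
      = 6 * (d' * m * (d : ℝ) ^ (-Real.log d)) := by ring
    _ ≤ 6 * (d ^ 3 * (d : ℝ) ^ (-Real.log d)) := by gcongr
end
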